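/- arXiv:2501.04676 — 2 statements merged into one kernel-verified Lean document; each statement's English description precedes it below -/
import Mathlib

section
/- Let a, ω > 0 with 3a > ω > 2a, and consider the scalar system x(n+1) = exp(−ω + a(n+1)cos(n+1) − an·cos(n) − a·sin(n+1) + a·sin(n)) x(n) on ℤ, whose evolution operator is Φ(k,n) = exp(−ω(k−n) + ak·cos(k) − an·cos(n) − a·sin(k) + a·sin(n)). With the exponential growth rate μ(n) = e^n: (a) the system admits a slow nonuniform exponential dichotomy with parameters (Id; −ω+a, *, 2a, *); (b) every nontrivial solution is unbounded on ℤ⁻, i.e. for every ξ ≠ 0 and n ∈ ℤ, sup_{k≤0} |Φ(k,n)ξ| = ∞, so the system has the Unbounded Solutions Property; (c) the system does not admit a slow nonuniform exponential dichotomy with projector 0, so it has the Unique Projector Property. -/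
open Filter Topology

noncomputable section

/-- The real-valued sign of an integer. -/
def sgnz (n : ℤ) : ℝ := (Int.sign n : ℝ)

/-- `Φ` is the evolution operator of the scalar system `x(k+1) = A(k) x(k)`
(with all `A k ≠ 0` this determines `Φ k n` for all `k, n ∈ ℤ`). -/
def sEvol (A : ℤ → ℝ) (Φ : ℤ → ℤ → ℝ) : Prop :=
  (∀ n, Φ n n = 1) ∧ (∀ k n, Φ (k + 1) n = A k * Φ k n)

/-- Scalar slow nonuniform μ-dichotomy with parameters `(P; α, β, θ, ν)` and constant `K`,
where the (constant) invariant projector `P` is `0` or `1 = Id`. -/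
def sSNmuD (μ : ℤ → ℝ) (Φ : ℤ → ℤ → ℝ) (P α β θ ν K : ℝ) : Prop :=
  (P = 0 ∨ P = 1) ∧ 1 ≤ K ∧ α < 0 ∧ 0 < β ∧ 0 ≤ θ ∧ 0 ≤ ν ∧
  (∀ k n : ℤ, n ≤ k → |Φ k n * P| ≤ K * (μ k / μ n) ^ α * μ n ^ (sgnz n * θ)) ∧
  (∀ k n : ℤ, k ≤ n → |Φ k n * (1 - P)| ≤ K * (μ k / μ n) ^ β * μ n ^ (sgnz n * ν))

/-- The Unbounded Solutions Property for a scalar system. -/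
def sUSP (Φ : ℤ → ℤ → ℝ) : Prop :=
  ∀ (n : ℤ) (ξ : ℝ), (∃ C : ℝ, ∀ k : ℤ, |Φ k n * ξ| ≤ C) → ξ = 0

/-- The Unique Projector Property for a scalar system (w.r.t. sNμD). -/
def sUPP (μ : ℤ → ℝ) (Φ : ℤ → ℤ → ℝ) : Prop :=
  ∀ P Q : ℝ, (∃ α β θ ν K, sSNmuD μ Φ P α β θ ν K) →
    (∃ α β θ ν K, sSNmuD μ Φ Q α β θ ν K) → P = Q


theorem mul_sgnz (n : ℤ) : (n : ℝ) * sgnz n = |(n : ℝ)| := by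
  rw [sgnz, ← Int.cast_mul, mul_comm, Int.sign_mul_self_eq_abs, Int.cast_abs]

theorem exponent_le {a : ℝ} (ha : 0 ≤ a) {k n : ℤ} (hkn : n ≤ k) :
    a * k * Real.cos k - a * n * Real.cos n - a * Real.sin k + a * Real.sin n ≤
      2 * a + a * (k - n) + 2 * a * |(n : ℝ)| := by
  have hkn' : (n : ℝ) ≤ k := by exact_mod_cast hkn
  have hcos : ∀ x : ℝ, |x * Real.cos x| ≤ |x| := fun x => by
    rw [abs_mul]
    exact mul_le_of_le_one_right (abs_nonneg x) (Real.abs_cos_le_one x)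
  have hk := (le_abs_self _).trans (hcos k)
  have hn := (neg_le_abs _).trans (hcos n)
  have hlin : |(k : ℝ)| + |(n : ℝ)| ≤ k - n + 2 * |(n : ℝ)| := by
    rcases abs_cases (k : ℝ) with h | h <;> rcases abs_cases (n : ℝ) with h' | h' <;> linarith
  have hsum : k * Real.cos k - n * Real.cos n - Real.sin k + Real.sin n ≤
      2 + (k - n) + 2 * |(n : ℝ)| := by
    linarith [Real.neg_one_le_sin k, Real.sin_le_one n]
  linarith [mul_le_mul_of_nonneg_left hsum ha]

/-- Example 2.10: for `3a > ω > 2a > 0`, the scalar system with evolution operator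
`Φ(k,n) = exp(-ω(k-n) + ak cos k - an cos n - a sin k + a sin n)` admits a slow
nonuniform exponential dichotomy with parameters `(Id; -ω+a, *, 2a, *)`, every nontrivial
solution is unbounded on `ℤ⁻` (so the system has the USP), and the system admits no slow
nonuniform exponential dichotomy with projector `0` (so it has the UPP). -/
theorem stmt3 (a ω : ℝ) (ha : 0 < a) (hω : 0 < ω) (h1 : 2 * a < ω) (h2 : ω < 3 * a)
    (μ : ℤ → ℝ) (hμ : ∀ n : ℤ, μ n = Real.exp (n : ℝ))
    (A : ℤ → ℝ)
    (hA : ∀ n : ℤ, A n = Real.exp (-ω + a * ((n : ℝ) + 1) * Real.cos ((n : ℝ) + 1)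
        - a * (n : ℝ) * Real.cos (n : ℝ) - a * Real.sin ((n : ℝ) + 1) + a * Real.sin (n : ℝ)))
    (Φ : ℤ → ℤ → ℝ)
    (hΦ : ∀ k n : ℤ, Φ k n = Real.exp (-ω * ((k : ℝ) - (n : ℝ))
        + a * (k : ℝ) * Real.cos (k : ℝ) - a * (n : ℝ) * Real.cos (n : ℝ)
        - a * Real.sin (k : ℝ) + a * Real.sin (n : ℝ))) :
    (∃ K : ℝ, ∀ β ν : ℝ, 0 < β → 0 ≤ ν → sSNmuD μ Φ 1 (-ω + a) β (2 * a) ν K) ∧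
    (∀ (n : ℤ) (ξ : ℝ), ξ ≠ 0 → ∀ C : ℝ, ∃ k : ℤ, k ≤ 0 ∧ C < |Φ k n * ξ|) ∧
    sUSP Φ ∧
    (¬ ∃ α β θ ν K, sSNmuD μ Φ 0 α β θ ν K) ∧
    sUPP μ Φ := by
  have hdich : ∀ β ν : ℝ, 0 < β → 0 ≤ ν →
      sSNmuD μ Φ 1 (-ω + a) β (2 * a) ν (Real.exp (2 * a)) := by
    intro β ν hβ hν
    refine ⟨Or.inr rfl, Real.one_le_exp (by linarith), by linarith, hβ, by linarith, hν,
      fun k n hkn => ?_, fun k n _ => ?_⟩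
    · rw [mul_one, hΦ, Real.abs_exp, hμ, hμ, ← Real.exp_sub, ← Real.exp_mul, ← Real.exp_mul,
        ← Real.exp_add, ← Real.exp_add, Real.exp_le_exp]
      have hexp := exponent_le ha.le hkn
      have habs : (n : ℝ) * (sgnz n * (2 * a)) = 2 * a * |(n : ℝ)| := by
        rw [← mul_sgnz n]; ring
      rw [habs]
      linarith
    · simp only [hμ, sub_self, mul_zero, abs_zero]
      positivity
  have hunb : ∀ (n : ℤ) (ξ : ℝ), ξ ≠ 0 → ∀ C : ℝ, ∃ k : ℤ, k ≤ 0 ∧ C < |Φ k n * ξ| := by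
    intro n ξ hξ C
    have hlim : Tendsto (fun m : ℕ => (m : ℝ) * (ω - a)) atTop atTop :=
      tendsto_natCast_atTop_atTop.atTop_mul_const (by linarith)
    set c : ℝ := ω * n - a * n * Real.cos n - a + a * Real.sin n with hc
    obtain ⟨m, hm⟩ := (hlim.eventually_ge_atTop (C / |ξ| - c)).exists
    refine ⟨-(m : ℤ), by simp, ?_⟩
    have hξ' : 0 < |ξ| := abs_pos.mpr hξ
    rw [hΦ, abs_mul, Real.abs_exp, ← div_lt_iff₀ hξ']
    refine lt_of_lt_of_le (b := Real.exp (C / |ξ|)) ?_ (Real.exp_le_exp.mpr ?_)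
    · linarith [Real.add_one_le_exp (C / |ξ|)]
    · push_cast
      have hcos : a * m * Real.cos (-m) ≤ a * m * 1 :=
        mul_le_mul_of_nonneg_left (Real.cos_le_one _) (by positivity)
      have hsin : a * Real.sin (-m) ≤ a * 1 :=
        mul_le_mul_of_nonneg_left (Real.sin_le_one _) ha.le
      linarith
  have hzero : ¬ ∃ α β θ ν K, sSNmuD μ Φ 0 α β θ ν K := by
    rintro ⟨α, β, θ, ν, K, -, hK1, -, hβ, -, -, -, hbound⟩
    obtain ⟨k, hk, hlt⟩ := hunb 0 1 one_ne_zero K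
    have hle := hbound k 0 hk
    have hkβ : (k : ℝ) * β ≤ 0 :=
      mul_nonpos_of_nonpos_of_nonneg (by exact_mod_cast hk) hβ.le
    have hpow : Real.exp ((k : ℝ) * β) ≤ 1 := Real.exp_le_one_iff.mpr hkβ
    simp only [hμ, Int.cast_zero, Real.exp_zero, div_one, Real.one_rpow, mul_one, sub_zero,
      ← Real.exp_mul] at hle hlt
    nlinarith
  refine ⟨⟨_, hdich⟩, hunb, fun n ξ ⟨C, hC⟩ => ?_, hzero, fun P Q hP hQ => ?_⟩
  · by_contra hξ
    obtain ⟨k, -, hlt⟩ := hunb n ξ hξ C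
    exact absurd (hC k) hlt.not_ge
  · have eq_one : ∀ R : ℝ, (∃ α β θ ν K, sSNmuD μ Φ R α β θ ν K) → R = 1 := by
      intro R hR
      obtain ⟨α, β, θ, ν, K, h⟩ := id hR
      rcases h.1 with rfl | rfl
      · exact absurd hR hzero
      · rfl
    rw [eq_one P hP, eq_one Q hQ]
end
end

section
/- Non-invariance of the nonuniform exponential dichotomy spectrum under weak kinematic similarity: Let a, ω > 0 with 3a > ω > a, and define the scalar systems x(n+1) = A(n)x(n) with A(n) = exp(−ω + a(n+1)cos(n+1) − an·cos(n) − a·sin(n+1) + a·sin(n)) and x(n+1) = B(n)x(n) with B(n) = exp(−(ω−a) + a(n+1)cos(n+1) − an·cos(n) − a·sin(n+1) + a·sin(n)), and take the exponential growth rate μ(n) = e^n. Then: (1) the evolution operator of the A-system satisfies |Φ(k,n)| ≤ e^{2a} e^{(ω+a)|k−n|} e^{2a|n|} for all k, n ∈ ℤ, so the A-system has nonuniform exponential bounded growth; (2) Σ_{NμD}(A) = [−ω−3a, −ω+3a]; (3) the A-system is μ-weakly kinematically similar to the B-system via the weakly nondegenerate map S(n) = e^{−an}; (4) Σ_{NμD}(B)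 = [−(ω−a)−3a, −(ω−a)+3a] = [−ω−2a, −ω+4a]. In particular, the A-system and the B-system are weakly kinematically similar but Σ_{NμD}(A) ≠ Σ_{NμD}(B). -/
open Filter Topology

noncomputable section

/-- Scalar nonuniform μ-dichotomy: a scalar sNμD with `α + θ < 0` and `β - ν > 0`. -/
def sNmuD (μ : ℤ → ℝ) (Φ : ℤ → ℤ → ℝ) (P α β θ ν K : ℝ) : Prop :=
  sSNmuD μ Φ P α β θ ν K ∧ α + θ < 0 ∧ 0 < β - ν

/-- Evolution operator of the scalar `(μ,γ)`-weighted system. -/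
def swPhi (μ : ℤ → ℝ) (Φ : ℤ → ℤ → ℝ) (γ : ℝ) : ℤ → ℤ → ℝ :=
  fun k n => (μ k / μ n) ^ (-γ) * Φ k n

/-- The scalar nonuniform μ-dichotomy spectrum. -/
def sSpecNmuD (μ : ℤ → ℝ) (Φ : ℤ → ℤ → ℝ) : Set ℝ :=
  {γ | ¬ ∃ P α β θ ν K, sNmuD μ (swPhi μ Φ γ) P α β θ ν K}

theorem sEvol.eq_exp {A : ℤ → ℝ} {Φ : ℤ → ℤ → ℝ} (h : sEvol A Φ) {u : ℤ → ℝ}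
    (hA : ∀ n, A n = Real.exp (u (n + 1) - u n)) (k n : ℤ) :
    Φ k n = Real.exp (u k - u n) := by
  induction k using Int.inductionOn' (b := n) with
  | zero => simp [h.1 n]
  | succ k _ ih =>
    rw [h.2, ih, hA, ← Real.exp_add]
    ring_nf
  | pred k _ ih =>
    have h2 := h.2 (k - 1) n
    rw [sub_add_cancel, hA, sub_add_cancel, ih] at h2
    have h3 : Real.exp (u k - u n)
        = Real.exp (u k - u (k - 1)) * Real.exp (u (k - 1) - u n) := by
      rw [← Real.exp_add]
      ring_nf
    rw [h3] at h2
    exact (mul_left_cancel₀ (Real.exp_ne_zero _) h2).symm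

/-- The oscillating part of the exponent of the evolution operators. -/
def oscPart (a : ℝ) (n : ℤ) : ℝ := a * n * Real.cos n - a * Real.sin n

theorem oscPart_neg (a : ℝ) (n : ℤ) : oscPart a (-n) = -oscPart a n := by
  simp only [oscPart, Int.cast_neg, Real.cos_neg, Real.sin_neg]
  ring

theorem oscPart_sub_le {a : ℝ} (ha : 0 < a) (k n : ℤ) :
    oscPart a k - oscPart a n ≤ a * |(k : ℝ) - n| + 2 * a * |(n : ℝ)| + 2 * a := by
  have e1 : ((k : ℝ) - n) * Real.cos k ≤ |(k : ℝ) - n| := by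
    refine (le_abs_self _).trans ?_
    rw [abs_mul]
    exact mul_le_of_le_one_right (abs_nonneg _) (Real.abs_cos_le_one _)
  have e2 : (n : ℝ) * (Real.cos k - Real.cos n) ≤ |(n : ℝ)| * 2 := by
    refine (le_abs_self _).trans ?_
    rw [abs_mul]
    refine mul_le_mul_of_nonneg_left ?_ (abs_nonneg _)
    rw [abs_le]
    constructor <;> linarith [Real.cos_le_one k, Real.cos_le_one n, Real.neg_one_le_cos k,
      Real.neg_one_le_cos n]
  have e3 : Real.sin n - Real.sin k ≤ 2 := by
    linarith [Real.sin_le_one n, Real.neg_one_le_sin k]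
  have := mul_le_mul_of_nonneg_left (add_le_add (add_le_add e1 e2) e3) ha.le
  simp only [oscPart]
  linarith

theorem exists_nat_cos_lt {ε : ℝ} (hε : 0 < ε) (N : ℕ) :
    ∃ n : ℕ, N ≤ n ∧ Real.cos n < -1 + ε := by
  induction N generalizing ε with
  | zero =>
    have hd : Dense (AddSubgroup.closure {1, 2 * Real.pi} : Set ℝ) := by
      rw [dense_addSubgroupClosure_pair_iff, one_div, irrational_inv_iff]
      exact_mod_cast irrational_pi.natCast_mul (m := 2) two_ne_zero
    have ho : IsOpen {x : ℝ | Real.cos x < -1 + ε} :=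
      isOpen_lt Real.continuous_cos continuous_const
    obtain ⟨x, hx, hx'⟩ := hd.exists_mem_open ho ⟨Real.pi, by simpa using hε⟩
    obtain ⟨m, j, rfl⟩ := AddSubgroup.mem_closure_pair.1 hx
    refine ⟨m.natAbs, Nat.zero_le _, ?_⟩
    simp only [zsmul_eq_mul, mul_one, Set.mem_ofPred_eq, Real.cos_add_int_mul_two_pi] at hx'
    rwa [Nat.cast_natAbs, Int.cast_abs, Real.cos_abs]
  | succ N ih =>
    have hN : Real.cos N ≠ -1 := by
      rw [Ne, Real.cos_eq_neg_one_iff]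
      rintro ⟨j, hj⟩
      have hj' : ((2 * j + 1 : ℤ) : ℝ) * Real.pi = (N : ℤ) := by
        push_cast
        linarith
      have hne : (2 * j + 1 : ℤ) ≠ 0 := by omega
      exact (irrational_pi.intCast_mul hne).ne_int N hj'
    have hN' : 0 < 1 + Real.cos N := by
      linarith [lt_of_le_of_ne (Real.neg_one_le_cos N) hN.symm]
    obtain ⟨n, hn, hc⟩ := ih (lt_min hε hN')
    refine ⟨n, ?_, hc.trans_le (by gcongr; exact min_le_left _ _)⟩
    refine Nat.succ_le_of_lt (lt_of_le_of_ne hn ?_)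
    rintro rfl
    linarith [min_le_right ε (1 + Real.cos N)]

theorem abs_sin_mul_sin_le {x y ε : ℝ} (hx : 1 - ε ≤ |Real.cos x|)
    (hy : 1 - ε ≤ |Real.cos y|) : |Real.sin x * Real.sin y| ≤ 2 * ε := by
  have key : ∀ z : ℝ, 1 - ε ≤ |Real.cos z| → Real.sin z ^ 2 ≤ 2 * ε := by
    intro z hz
    have h1 := Real.sin_sq_add_cos_sq z
    rw [← sq_abs (Real.cos z)] at h1
    nlinarith [sq_nonneg (|Real.cos z| - 1)]
  have h1 := key x hx
  have h2 := key y hy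
  rw [abs_le]
  constructor <;> nlinarith [sq_nonneg (Real.sin x - Real.sin y),
    sq_nonneg (Real.sin x + Real.sin y)]

/-- Sequences that jump from near `-1` to near `1` within a bounded gap infinitely often. -/
def JumpsUp (c : ℕ → ℝ) : Prop :=
  ∀ ε > 0, ∃ d : ℕ, ∀ N : ℕ, ∃ n ≥ N, c n ≤ -1 + ε ∧ 1 - ε ≤ c (n + d)

theorem jumpsUp_cos : JumpsUp fun n => Real.cos n := by
  intro ε hε
  have hδ : 0 < ε / 4 := by positivity
  obtain ⟨d, -, hd⟩ := exists_nat_cos_lt hδ 0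
  refine ⟨d, fun N => ?_⟩
  obtain ⟨n, hn, hc⟩ := exists_nat_cos_lt hδ N
  have hs := abs_sin_mul_sin_le (x := n) (y := d) (ε := ε / 4)
    (by linarith [neg_le_abs (Real.cos n)]) (by linarith [neg_le_abs (Real.cos d)])
  refine ⟨n, hn, by linarith, ?_⟩
  push_cast
  rw [Real.cos_add]
  nlinarith [(abs_le.1 hs).2, Real.neg_one_le_cos n, Real.neg_one_le_cos d]

theorem jumpsUp_neg_cos : JumpsUp fun n => -Real.cos n := by
  intro ε hε
  have hδ : 0 < min (ε / 16) 1 := by positivity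
  have hδ1 : min (ε / 16) 1 ≤ 1 := min_le_right _ _
  have hδ2 : min (ε / 16) 1 ≤ ε / 16 := min_le_left _ _
  generalize min (ε / 16) 1 = δ at hδ hδ1 hδ2
  obtain ⟨d, -, hd⟩ := exists_nat_cos_lt hδ 0
  refine ⟨d, fun N => ?_⟩
  obtain ⟨n, hn, hc⟩ := exists_nat_cos_lt hδ N
  have hn2 : 1 - 4 * δ ≤ Real.cos ((2 * n : ℕ) : ℝ) := by
    push_cast
    rw [Real.cos_two_mul]
    nlinarith [sq_nonneg (Real.cos n + 1)]
  have hs := abs_sin_mul_sin_le (x := ((2 * n : ℕ) : ℝ)) (y := d) (ε := 4 * δ)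
    (by linarith [le_abs_self (Real.cos ((2 * n : ℕ) : ℝ))])
    (by linarith [neg_le_abs (Real.cos d)])
  refine ⟨2 * n, by omega, by linarith, ?_⟩
  simp only [Nat.cast_add (2 * n) d, Real.cos_add]
  nlinarith [(abs_le.1 hs).1, Real.cos_le_one ((2 * n : ℕ) : ℝ), Real.neg_one_le_cos d]

theorem nonpos_of_frequently_mul_le {x C : ℝ}
    (h : ∀ N : ℕ, ∃ n ≥ N, x * (n : ℝ) ≤ C) : x ≤ 0 := by
  by_contra! hx
  obtain ⟨N, hN⟩ := exists_nat_gt (C / x)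
  obtain ⟨n, hn, hc⟩ := h N
  have hn' : (N : ℝ) ≤ n := by exact_mod_cast hn
  rw [div_lt_iff₀ hx] at hN
  nlinarith

theorem JumpsUp.three_mul_le {c : ℕ → ℝ} (hc : JumpsUp c) {a δ α θ C : ℝ} (ha : 0 < a)
    (h : ∀ n k : ℕ, n ≤ k →
      a * (k * c k - n * c n) - δ * ((k : ℝ) - n) ≤ C + α * ((k : ℝ) - n) + θ * n) :
    3 * a ≤ δ + α + θ := by
  refine le_of_forall_pos_le_add fun η hη => ?_
  obtain ⟨d, hd⟩ := hc (η / (3 * a)) (by positivity)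
  have hεη : 3 * (a * (η / (3 * a))) = η := by field_simp
  generalize η / (3 * a) = ε at hd hεη
  have hθ : 2 * a * (1 - ε) - θ ≤ 0 := by
    refine nonpos_of_frequently_mul_le
      (C := C + (α + δ) * d - a * (1 - ε) * d) fun N => ?_
    obtain ⟨n, hn, h1, h2⟩ := hd N
    refine ⟨n, hn, ?_⟩
    have h3 := h n (n + d) (Nat.le_add_right _ _)
    push_cast at h3
    have h4 := mul_le_mul_of_nonneg_left h1 (by positivity : 0 ≤ a * (n : ℝ))
    have h5 := mul_le_mul_of_nonneg_left h2 (by positivity : 0 ≤ a * ((n : ℝ) + d))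
    linarith
  have hα : a * (1 - ε) - (δ + α) ≤ 0 := by
    refine nonpos_of_frequently_mul_le (C := C) fun N => ?_
    obtain ⟨n, hn, -, h2⟩ := hd N
    refine ⟨n + d, by omega, ?_⟩
    have h3 := h 0 (n + d) (Nat.zero_le _)
    push_cast at h3 ⊢
    have h5 := mul_le_mul_of_nonneg_left h2 (by positivity : 0 ≤ a * ((n : ℝ) + d))
    linarith
  linarith

theorem three_mul_le_of_oscPart_sub_le {a δ α θ C : ℝ} (ha : 0 < a)
    (h : ∀ k n : ℤ, n ≤ k →
      oscPart a k - oscPart a n - δ * ((k : ℝ) - n) ≤ C + α * ((k : ℝ) - n) + θ * |(n : ℝ)|) :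
    3 * a ≤ δ + α + θ := by
  refine jumpsUp_cos.three_mul_le (C := C + 2 * a) ha fun n k hnk => ?_
  have h1 := h k n (by exact_mod_cast hnk)
  have h2 := mul_le_mul_of_nonneg_left (Real.sin_le_one k) ha.le
  have h3 := mul_le_mul_of_nonneg_left (Real.neg_one_le_sin n) ha.le
  simp only [oscPart, Int.cast_natCast, Nat.abs_cast] at h1
  linarith

theorem three_mul_le_of_oscPart_sub_le' {a δ α θ C : ℝ} (ha : 0 < a)
    (h : ∀ k n : ℤ, k ≤ n →
      oscPart a k - oscPart a n - δ * ((k : ℝ) - n) ≤ C + α * ((k : ℝ) - n) + θ * |(n : ℝ)|) :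
    3 * a ≤ -δ - α + θ := by
  have := jumpsUp_neg_cos.three_mul_le (C := C + 2 * a) (δ := -δ) (α := -α) (θ := θ) ha
    fun n k hnk => by
      have h1 := h (-k) (-n) (by omega)
      have h2 := mul_le_mul_of_nonneg_left (Real.sin_le_one n) ha.le
      have h3 := mul_le_mul_of_nonneg_left (Real.neg_one_le_sin k) ha.le
      rw [oscPart_neg, oscPart_neg] at h1
      simp only [oscPart, Int.cast_neg, Int.cast_natCast, abs_neg, Nat.abs_cast] at h1
      linarith
  linarith

theorem exp_rpow_sgnz_mul (n : ℤ) (θ : ℝ) :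
    Real.exp n ^ (sgnz n * θ) = Real.exp (θ * |(n : ℝ)|) := by
  have h : (Int.sign n : ℝ) * n = |(n : ℝ)| := by exact_mod_cast Int.sign_mul_self_eq_abs n
  rw [← Real.exp_mul, sgnz, ← h]
  ring_nf

theorem dichotomy_bound_iff {K : ℝ} (hK : 0 < K) (E α θ : ℝ) (k n : ℤ) :
    |Real.exp E| ≤ K * (Real.exp k / Real.exp n) ^ α * Real.exp n ^ (sgnz n * θ) ↔
      E ≤ Real.log K + α * ((k : ℝ) - n) + θ * |(n : ℝ)| := by
  rw [Real.abs_exp, exp_rpow_sgnz_mul, ← Real.exp_sub, ← Real.exp_mul]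
  nth_rewrite 1 [← Real.exp_log hK]
  rw [← Real.exp_add, ← Real.exp_add, Real.exp_le_exp, mul_comm ((k : ℝ) - n)]

theorem sSpecNmuD_exp_oscPart {a ω : ℝ} (ha : 0 < a) {μ : ℤ → ℝ}
    (hμ : ∀ n : ℤ, μ n = Real.exp n) {Φ : ℤ → ℤ → ℝ}
    (hΦ : ∀ k n : ℤ,
      Φ k n = Real.exp (oscPart a k - oscPart a n - ω * ((k : ℝ) - n))) :
    sSpecNmuD μ Φ = Set.Icc (-ω - 3 * a) (-ω + 3 * a) := by
  have hw : ∀ (γ : ℝ) (k n : ℤ), swPhi μ Φ γ k n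
      = Real.exp (oscPart a k - oscPart a n - (γ + ω) * ((k : ℝ) - n)) := by
    intro γ k n
    rw [swPhi, hμ, hμ, hΦ, ← Real.exp_sub, ← Real.exp_mul, ← Real.exp_add]
    ring_nf
  ext γ
  rw [sSpecNmuD, Set.mem_ofPred_eq, Set.mem_Icc, not_iff_comm, not_and_or, not_le, not_le]
  constructor
  · intro h
    have hK : Real.log (Real.exp (2 * a)) = 2 * a := Real.log_exp _
    have hK1 : 1 ≤ Real.exp (2 * a) := Real.one_le_exp (by positivity)
    have hpos : ∀ α θ : ℝ, ∀ k n : ℤ, 0 ≤ Real.exp (2 * a) * (μ k / μ n) ^ α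
        * μ n ^ (sgnz n * θ) := by
      intro α θ k n
      rw [hμ, hμ]
      positivity
    rcases h with h | h
    · refine ⟨0, -1, -(γ + ω) - a, 0, 2 * a, Real.exp (2 * a), ⟨Or.inl rfl, hK1, by norm_num,
        by linarith, le_rfl, by positivity, ?_, ?_⟩, by norm_num, by linarith⟩
      · intro k n _
        rw [mul_zero, abs_zero]
        exact hpos _ _ _ _
      · intro k n hkn
        rw [sub_zero, mul_one, hw, hμ, hμ, dichotomy_bound_iff (Real.exp_pos _), hK]
        have h1 := oscPart_sub_le ha k n
        have hkn' : (k : ℝ) - n ≤ 0 := sub_nonpos.2 (by exact_mod_cast hkn)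
        rw [abs_of_nonpos hkn'] at h1
        linarith
    · refine ⟨1, a - (γ + ω), 1, 2 * a, 0, Real.exp (2 * a), ⟨Or.inr rfl, hK1, by linarith,
        by norm_num, by positivity, le_rfl, ?_, ?_⟩, by linarith, by norm_num⟩
      · intro k n hkn
        rw [mul_one, hw, hμ, hμ, dichotomy_bound_iff (Real.exp_pos _), hK]
        have h1 := oscPart_sub_le ha k n
        have hkn' : 0 ≤ (k : ℝ) - n := sub_nonneg.2 (by exact_mod_cast hkn)
        rw [abs_of_nonneg hkn'] at h1
        linarith
      · intro k n _
        rw [sub_self, mul_zero, abs_zero]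
        exact hpos _ _ _ _
  · rintro ⟨P, α, β, θ, ν, K, ⟨hP, hK, -, -, -, -, hf, hb⟩, hαθ, hβν⟩
    have hK0 : 0 < K := by linarith
    rcases hP with rfl | rfl
    · left
      have := three_mul_le_of_oscPart_sub_le' (δ := γ + ω) (α := β) (θ := ν) ha
        fun k n hkn => by
          have h1 := hb k n hkn
          rwa [sub_zero, mul_one, hw, hμ, hμ, dichotomy_bound_iff hK0] at h1
      linarith
    · right
      have := three_mul_le_of_oscPart_sub_le (δ := γ + ω) (α := α) (θ := θ) ha
        fun k n hkn => by
          have h1 := hf k n hkn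
          rwa [mul_one, hw, hμ, hμ, dichotomy_bound_iff hK0] at h1
      linarith

/-- Example 5.8: non-invariance of the nonuniform exponential dichotomy spectrum under
weak kinematic similarity.  For `3a > ω > a > 0`, the `A`-system has nonuniform
exponential bounded growth, `Σ_{NμD}(A) = [-ω-3a, -ω+3a]`, it is μ-weakly kinematically
similar to the `B`-system via `S(n) = e^{-an}`, yet
`Σ_{NμD}(B) = [-ω-2a, -ω+4a] ≠ Σ_{NμD}(A)`. -/
theorem stmt19 (a ω : ℝ) (ha : 0 < a) (hω : 0 < ω) (h1 : a < ω) (h2 : ω < 3 * a)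
    (μ : ℤ → ℝ) (hμ : ∀ n : ℤ, μ n = Real.exp (n : ℝ))
    (A B : ℤ → ℝ)
    (hA : ∀ n : ℤ, A n = Real.exp (-ω + a * ((n : ℝ) + 1) * Real.cos ((n : ℝ) + 1)
        - a * (n : ℝ) * Real.cos (n : ℝ) - a * Real.sin ((n : ℝ) + 1) + a * Real.sin (n : ℝ)))
    (hB : ∀ n : ℤ, B n = Real.exp (-(ω - a) + a * ((n : ℝ) + 1) * Real.cos ((n : ℝ) + 1)
        - a * (n : ℝ) * Real.cos (n : ℝ) - a * Real.sin ((n : ℝ) + 1) + a * Real.sin (n : ℝ)))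
    (ΦA ΦB : ℤ → ℤ → ℝ) (hΦA : sEvol A ΦA) (hΦB : sEvol B ΦB) :
    (∀ k n : ℤ, |ΦA k n| ≤ Real.exp (2 * a) * Real.exp ((ω + a) * |(k : ℝ) - (n : ℝ)|)
        * Real.exp (2 * a * |(n : ℝ)|)) ∧
    sSpecNmuD μ ΦA = Set.Icc (-ω - 3 * a) (-ω + 3 * a) ∧
    (∃ M : ℝ, 0 < M ∧
      (∀ k : ℤ, |Real.exp (-a * (k : ℝ))| ≤ M * μ k ^ (sgnz k * (2 * a)) ∧
        |Real.exp (-a * (k : ℝ))|⁻¹ ≤ M * μ k ^ (sgnz k * (2 * a))) ∧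
      (∀ k : ℤ, Real.exp (-a * ((k : ℝ) + 1)) * B k = A k * Real.exp (-a * (k : ℝ)))) ∧
    sSpecNmuD μ ΦB = Set.Icc (-ω - 2 * a) (-ω + 4 * a) ∧
    sSpecNmuD μ ΦA ≠ sSpecNmuD μ ΦB := by
  have key : ∀ (w : ℝ) (D : ℤ → ℝ) (Φ : ℤ → ℤ → ℝ), sEvol D Φ →
      (∀ n : ℤ, D n = Real.exp (-w + a * ((n : ℝ) + 1) * Real.cos ((n : ℝ) + 1)
        - a * (n : ℝ) * Real.cos (n : ℝ) - a * Real.sin ((n : ℝ) + 1) + a * Real.sin (n : ℝ))) →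
      ∀ k n : ℤ, Φ k n = Real.exp (oscPart a k - oscPart a n - w * ((k : ℝ) - n)) := by
    intro w D Φ hΦ hD k n
    rw [hΦ.eq_exp (u := fun n => oscPart a n - w * n)]
    · ring_nf
    · intro n
      rw [hD]
      simp only [oscPart]
      push_cast
      ring_nf
  have hA' := key ω A ΦA hΦA hA
  have hB' := key (ω - a) B ΦB hΦB hB
  have sA := sSpecNmuD_exp_oscPart ha hμ hA'
  have sB : sSpecNmuD μ ΦB = Set.Icc (-ω - 2 * a) (-ω + 4 * a) := by
    rw [sSpecNmuD_exp_oscPart ha hμ hB']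
    ring_nf
  refine ⟨fun k n => ?_, sA, ⟨1, one_pos, fun k => ?_, fun k => ?_⟩, sB, ?_⟩
  · rw [hA', Real.abs_exp, ← Real.exp_add, ← Real.exp_add, Real.exp_le_exp]
    have := mul_le_mul_of_nonneg_left (neg_le_abs ((k : ℝ) - n)) hω.le
    linarith [oscPart_sub_le ha k n]
  · rw [hμ, exp_rpow_sgnz_mul, Real.abs_exp, ← Real.exp_neg, one_mul, Real.exp_le_exp,
      Real.exp_le_exp]
    have e1 := mul_le_mul_of_nonneg_left (neg_le_abs (k : ℝ)) ha.le
    have e2 := mul_le_mul_of_nonneg_left (le_abs_self (k : ℝ)) ha.le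
    have e3 := mul_nonneg ha.le (abs_nonneg (k : ℝ))
    constructor <;> linarith
  · rw [hA, hB, ← Real.exp_add, ← Real.exp_add]
    ring_nf
  · rw [sA, sB]
    intro h
    have hm : -ω - 3 * a ∈ Set.Icc (-ω - 3 * a) (-ω + 3 * a) :=
      ⟨le_rfl, by linarith⟩
    rw [h] at hm
    linarith [hm.1]
end
end
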